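/- Let α be a closed rational 1-form over K = ℂ(x₁, …, xₙ), i.e., α = ∑ a_i dx_i with a_i ∈ K and ∂a_i/∂x_j = ∂a_j/∂x_i for all i, j. Then there exist rational functions g, f, f₁, …, f_r ∈ ℂ[x₁,…,xₙ] (with f, f_i nonzero) and complex constants a₁, …, a_r such that α = d(g/f) + ∑_{i=1}^r a_i · df_i / f_i. In other words, every closed rational 1-form is the logarithmic differential of a Darboux function exp(g/f)·∏ f_i^{a_i}. -/

import Mathlib

namespace Darb
open Polynomial

section core
variable {F K : Type*} [Field F] [Field K]

/-- coefficientwise application of an additive map -/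
noncomputable def cm (d : F →+ F) (p : F[X]) : F[X] :=
  ∑ i ∈ Finset.range (p.natDegree + 1), monomial i (d (p.coeff i))

lemma coeff_cm (d : F →+ F) (p : F[X]) (i : ℕ) : (cm d p).coeff i = d (p.coeff i) := by
  unfold cm
  simp only [finsetSum_coeff, coeff_monomial]
  rw [Finset.sum_ite_eq']
  split_ifs with h
  · rfl
  · rw [coeff_eq_zero_of_natDegree_lt (by simpa using h), map_zero]

lemma cm_add (d : F →+ F) (p q : F[X]) : cm d (p + q) = cm d p + cm d q := by
  ext i; simp [coeff_cm]

lemma cm_monomial (d : F →+ F) (n : ℕ) (a : F) : cm d (monomial n a) = monomial n (d a) := by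
  ext i; simp [coeff_cm, coeff_monomial, apply_ite d]

lemma chain (φ : F[X] →+* K) (D : Derivation ℤ K K) (d : F →+ F)
    (hC : ∀ a, D (φ (C a)) = φ (C (d a))) (μ ρ : F[X]) :
    D (φ (μ.comp ρ)) = φ ((cm d μ).comp ρ) + φ (μ.derivative.comp ρ) * D (φ ρ) := by
  induction μ using Polynomial.induction_on' with
  | add p q hp hq => simp only [add_comp, map_add, cm_add, hp, hq]; ring
  | monomial n a =>
    simp only [cm_monomial, monomial_comp, derivative_monomial, map_mul, map_pow,
      Derivation.leibniz, Derivation.leibniz_pow, hC, smul_eq_mul, nsmul_eq_mul, map_natCast]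
    ring

/-- regular at `q` -/
def Reg (φ : F[X] →+* K) (q : F[X]) (z : K) : Prop := ∃ P Q, ¬ q ∣ Q ∧ z * φ Q = φ P

variable {φ : F[X] →+* K} {q : F[X]}

lemma Reg.of
    (hq : Irreducible q) (p : F[X]) : Reg φ q (φ p) :=
  ⟨p, 1, fun h => hq.not_isUnit (isUnit_of_dvd_one h), by simp⟩

lemma Reg.neg {z : K} (h : Reg φ q z) : Reg φ q (-z) := by
  obtain ⟨P, Q, h1, h2⟩ := h
  exact ⟨-P, Q, h1, by rw [map_neg, ← h2]; ring⟩

lemma Reg.add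
    (hq : Irreducible q) {z w : K} (h : Reg φ q z) (h' : Reg φ q w) : Reg φ q (z + w) := by
  obtain ⟨P, Q, h1, h2⟩ := h
  obtain ⟨P', Q', h1', h2'⟩ := h'
  refine ⟨P * Q' + P' * Q, Q * Q', fun h => (hq.prime.dvd_or_dvd h).elim h1 h1', ?_⟩
  simp only [map_add, map_mul, ← h2, ← h2']; ring

lemma Reg.sub
    (hq : Irreducible q) {z w : K} (h : Reg φ q z) (h' : Reg φ q w) : Reg φ q (z - w) := by
  rw [sub_eq_add_neg]; exact h.add hq h'.neg

lemma Reg.mul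
    (hq : Irreducible q) {z w : K} (h : Reg φ q z) (h' : Reg φ q w) : Reg φ q (z * w) := by
  obtain ⟨P, Q, h1, h2⟩ := h
  obtain ⟨P', Q', h1', h2'⟩ := h'
  refine ⟨P * P', Q * Q', fun h => (hq.prime.dvd_or_dvd h).elim h1 h1', ?_⟩
  simp only [map_mul, ← h2, ← h2']; ring

lemma Reg.sum
    (hq : Irreducible q) {ι : Type*} (s : Finset ι) (f : ι → K) (h : ∀ i ∈ s, Reg φ q (f i)) :
    Reg φ q (∑ i ∈ s, f i) := by
  classical
  induction s using Finset.induction_on with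
  | empty => simpa using Reg.of (φ := φ) hq 0
  | insert a s ha ih =>
    rw [Finset.sum_insert ha]
    exact (h a (by simp)).add hq (ih fun i hi => h i (by simp [hi]))

lemma Reg.cancel
    (hq : Irreducible q) {z : K} (u : F[X]) (hu : ¬ q ∣ u) (h : Reg φ q (φ u * z)) : Reg φ q z := by
  obtain ⟨P, Q, h1, h2⟩ := h
  refine ⟨P, u * Q, fun h => (hq.prime.dvd_or_dvd h).elim hu h1, ?_⟩
  rw [← h2, map_mul]; ring

lemma Reg.dvd
    (hφ : Function.Injective φ)
    (hq : Irreducible q) {p : F[X]} (h : Reg φ q (φ p / φ q)) : q ∣ p := by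
  obtain ⟨P, Q, h1, h2⟩ := h
  have hq0 : φ q ≠ 0 := (map_ne_zero_iff φ hφ).2 hq.ne_zero
  have : p * Q = q * P := by
    apply hφ
    rw [map_mul, map_mul, ← h2]; field_simp
  exact (hq.prime.dvd_or_dvd (Dvd.intro _ this.symm)).resolve_right h1

lemma Reg.der
    (hq : Irreducible q) {z : K} (D : Derivation ℤ K K) (E : F[X] → F[X]) (hD : ∀ p, D (φ p) = φ (E p))
    (h : Reg φ q z) : Reg φ q (D z) := by
  obtain ⟨P, Q, h1, h2⟩ := h
  refine ⟨E P * Q - P * E Q, Q * Q, fun h => (hq.prime.dvd_or_dvd h).elim h1 h1, ?_⟩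
  have := congrArg D h2
  simp only [Derivation.leibniz, smul_eq_mul, hD] at this
  simp only [map_sub, map_mul, ← h2, ← this]
  ring

lemma not_dvd_derivative [CharZero F] (hq : Irreducible q) : ¬ q ∣ derivative q := by
  intro h
  have hd : q.natDegree ≠ 0 := hq.natDegree_pos.ne'
  have h0 : derivative q ≠ 0 := by
    intro h0; exact hd (derivative_eq_zero.1 h0)
  exact absurd (degree_le_of_dvd h h0) (not_le.2 (degree_derivative_lt hq.ne_zero))

/-- pole order lemma -/
lemma pole
    (hφ : Function.Injective φ)
    (hq : Irreducible q) [CharZero F] (τ : Derivation ℤ K K) (hτ : ∀ p, τ (φ p) = φ (derivative p))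
    {b : K} (hb : ∃ P Q : F[X], b = φ P / φ Q) (h : Reg φ q (φ q ^ 2 * τ b)) :
    Reg φ q (φ q * b) := by
  classical
  have hq0 : φ q ≠ 0 := (map_ne_zero_iff φ hφ).2 hq.ne_zero
  have hex : ∃ k, Reg φ q (φ q ^ k * b) := by
    obtain ⟨P, Q, rfl⟩ := hb
    by_cases hQ : Q = 0
    · exact ⟨0, by simpa [hQ] using Reg.of (φ := φ) hq 0⟩
    obtain ⟨k, Q', h1, h2⟩ := WfDvdMonoid.max_power_factor hQ hq
    refine ⟨k, P, Q', h1, ?_⟩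
    have : φ Q' ≠ 0 := (map_ne_zero_iff φ hφ).2 (by rintro rfl; simp at h1)
    rw [h2, map_mul, map_pow]; field_simp
  have key : ∀ k, Reg φ q (φ q ^ (k+1) * b) → Reg φ q (φ q * b) := by
    intro k
    induction k with
    | zero => simp
    | succ k ih =>
      intro hk
      apply ih
      have h1 := hk.der hq τ _ hτ
      have h2 : Reg φ q (φ q ^ (k+1+1) * τ b) := by
        have := (Reg.of (φ := φ) hq (q ^ k)).mul hq h
        convert this using 1
        rw [map_pow]; ring
      have h3 := h1.sub hq h2
      apply Reg.cancel hq _ (not_dvd_derivative hq)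
      apply Reg.cancel hq (C ((k + 1 + 1 : ℕ) : F))
      · intro hdv
        refine hq.not_isUnit (isUnit_of_dvd_unit hdv ?_)
        exact isUnit_C.2 (Nat.cast_ne_zero.2 (by omega)).isUnit
      · convert h3 using 1
        simp only [Derivation.leibniz, Derivation.leibniz_pow, smul_eq_mul, nsmul_eq_mul, hτ,
          map_natCast]
        simp only [Nat.add_sub_cancel]
        ring
  obtain ⟨k, hk⟩ := hex
  apply key k
  have := (Reg.of (φ := φ) hq q).mul hq hk
  convert this using 1; ring

lemma resid
    (hφ : Function.Injective φ)
    (hq : Irreducible q) [CharZero F] (τ D : Derivation ℤ K K) (hτ : ∀ p, τ (φ p) = φ (derivative p))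
    (E : F[X] → F[X]) (hD : ∀ p, D (φ p) = φ (E p)) (hc : ∀ z, D (τ z) = τ (D z))
    (ρ : F[X]) (G b : K) (hG : Reg φ q G) (hb : ∃ P Q : F[X], b = φ P / φ Q)
    (h : D (φ ρ * φ (derivative q) / φ q + G) = τ b) :
    q ∣ E ρ * derivative q - derivative ρ * E q := by
  have hq0 : φ q ≠ 0 := (map_ne_zero_iff φ hφ).2 hq.ne_zero
  have of := Reg.of (φ := φ) hq
  have hDG := hG.der hq D E hD
  have e1 : D (φ ρ * φ (derivative q) / φ q) =
      φ (E ρ * derivative q + ρ * E (derivative q)) / φ q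
        - φ (ρ * derivative q * E q) / φ q ^ 2 := by
    rw [Derivation.leibniz_div]
    simp only [Derivation.leibniz, smul_eq_mul, hD, map_add, map_mul]
    field_simp
    ring
  have hb1 : Reg φ q (φ q * b) := by
    apply pole hφ hq τ hτ hb
    rw [← h, map_add, e1]
    have := ((of (q * (E ρ * derivative q + ρ * E (derivative q)) - ρ * derivative q * E q))).add hq
      ((of (q^2)).mul hq hDG)
    convert this using 1
    simp only [map_sub, map_mul, map_add, map_pow]
    field_simp
  have hb2 : Reg φ q (b - φ (ρ * E q) / φ q) := by
    apply Reg.cancel hq _ (not_dvd_derivative hq)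
    have t1 := hb1.der hq τ _ hτ
    have t2 := ((of (E ρ * derivative q + ρ * E (derivative q)))).add hq ((of q).mul hq hDG)
    have := t1.sub hq t2
    convert this using 1
    simp only [Derivation.leibniz, smul_eq_mul, hτ, ← h]
    rw [map_add, e1]
    simp only [map_mul, map_add]
    field_simp
    ring
  have hb3 := hb2.der hq τ _ hτ
  have := hb3.sub hq hDG
  apply Reg.dvd hφ hq
  convert this using 1
  rw [map_sub τ, ← h, map_add, e1, Derivation.leibniz_div]
  have hcq : φ (E (derivative q)) = φ (derivative (E q)) := by
    rw [← hD, ← hτ, ← hτ, ← hD, hc]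
  simp only [Derivation.leibniz, smul_eq_mul, hτ, map_sub, map_add, map_mul, hcq]
  field_simp
  ring

lemma const
    (hφ : Function.Injective φ) [CharZero F] {k : Type*} [Field k] [IsAlgClosed k] [Algebra k F] {ι : Type*}
    (d : ι → F →+ F) (D : ι → Derivation ℤ K K) (τ : Derivation ℤ K K)
    (hτ : ∀ p, τ (φ p) = φ (derivative p))
    (hC : ∀ j a, D j (φ (C a)) = φ (C (d j a))) (hX : ∀ j, D j (φ X) = 0)
    (hk : ∀ a : F, (∀ j, d j a = 0) → a ∈ (algebraMap k F).range)
    (h1 : ∀ j, d j 1 = 0)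
    (hq : Irreducible q) (ρ : F[X])
    (h : ∀ j, q ∣ cm (d j) ρ * derivative q - derivative ρ * cm (d j) q) :
    ∃ c : k, q ∣ ρ - C (algebraMap k F c) := by
  have : Fact (Irreducible q) := ⟨hq⟩
  have hD : ∀ j p, D j (φ p) = φ (cm (d j) p) := by
    intro j p
    have := chain φ (D j) (d j) (hC j) p X
    simpa [hX] using this
  let r : AdjoinRoot q := AdjoinRoot.mk q ρ
  have hIntg : IsIntegral F r := by
    have := (AdjoinRoot.powerBasis hq.ne_zero).finite
    exact IsIntegral.of_finite F r
  have hae : ∀ p : F[X], aeval r p = AdjoinRoot.mk q (p.comp ρ) := by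
    intro p
    rw [comp_eq_aeval]
    exact aeval_algHom_apply (AdjoinRoot.mkₐ q) ρ p
  set μ := minpoly F r with hμ
  have hμm : μ.Monic := minpoly.monic hIntg
  have hdvd : q ∣ μ.comp ρ := by
    rw [← AdjoinRoot.mk_eq_zero, ← hae, minpoly.aeval]
  obtain ⟨w, hw⟩ := hdvd
  have hcm : ∀ j, cm (d j) μ = 0 := by
    intro j
    by_contra hne
    have hdv : q ∣ (cm (d j) μ).comp ρ := by
      have e : derivative q * (cm (d j) μ).comp ρ =
          q * (derivative q * cm (d j) w - cm (d j) q * derivative w)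
          - (derivative μ).comp ρ *
            (cm (d j) ρ * derivative q - derivative ρ * cm (d j) q) := by
        apply hφ
        have c1 := chain φ (D j) (d j) (hC j) μ ρ
        have c2 := congrArg φ (derivative_comp μ ρ)
        rw [← hτ] at c2
        rw [hw] at c1 c2
        simp only [map_mul, Derivation.leibniz, smul_eq_mul, hτ, hD] at c1 c2
        simp only [map_mul, map_sub]
        linear_combination φ (cm (d j) q) * c2 - φ (derivative q) * c1
      have : q ∣ derivative q * (cm (d j) μ).comp ρ := by
        rw [e]
        exact dvd_sub (dvd_mul_right _ _) (dvd_mul_of_dvd_right (h j) _)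
      exact (hq.prime.dvd_or_dvd this).resolve_left (not_dvd_derivative hq)
    have h0 : aeval r (cm (d j) μ) = 0 := by rw [hae, AdjoinRoot.mk_eq_zero]; exact hdv
    have hle := minpoly.degree_le_of_ne_zero F r hne h0
    have hlt : (cm (d j) μ).degree < μ.degree := by
      rw [degree_eq_natDegree hμm.ne_zero, degree_lt_iff_coeff_zero]
      intro m hm
      rw [coeff_cm]
      rcases hm.eq_or_lt with rfl | hm
      · rw [hμm.coeff_natDegree, h1]
      · rw [coeff_eq_zero_of_natDegree_lt hm, map_zero]
    exact absurd hle (not_le.2 hlt)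
  have hlift : μ ∈ lifts (algebraMap k F) := by
    rw [lifts_iff_coeff_lifts]
    intro i
    apply hk
    intro j
    rw [← coeff_cm, hcm, coeff_zero]
  obtain ⟨ν, hν⟩ := hlift
  have hν' : ν.map (algebraMap k F) = μ := hν
  have hdeg : ν.degree ≠ 0 := by
    rw [← degree_map ν (algebraMap k F), hν']
    exact (minpoly.degree_pos hIntg).ne'
  obtain ⟨c, hc⟩ := IsAlgClosed.exists_root ν hdeg
  refine ⟨c, ?_⟩
  have hroot : IsRoot μ (algebraMap k F c) := by rw [← hν']; exact hc.map
  have := minpoly.root hIntg hroot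
  rw [← AdjoinRoot.mk_eq_zero, map_sub, AdjoinRoot.mk_C, ← AdjoinRoot.algebraMap_eq, this]
  simp [r]

lemma antideriv [CharZero F] (p : F[X]) : ∃ P, derivative P = p := by
  induction p using Polynomial.induction_on' with
  | add p q hp hq =>
    obtain ⟨P, rfl⟩ := hp
    obtain ⟨Q, rfl⟩ := hq
    exact ⟨P + Q, by simp⟩
  | monomial n a =>
    refine ⟨monomial (n+1) (a / (n+1)), ?_⟩
    have : (n : F) + 1 ≠ 0 := by exact_mod_cast Nat.succ_ne_zero n
    rw [derivative_monomial]
    congr 1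
    push_cast
    field_simp

lemma hermite
    (hφ : Function.Injective φ)
    (hq : Irreducible q) [CharZero F] [CharZero K] (τ : Derivation ℤ K K)
    (hτ : ∀ p, τ (φ p) = φ (derivative p))
    (L : Subfield K) (hL : ∀ p, φ p ∈ L) (m : ℕ) :
    ∀ r, ∃ h ∈ L, ∃ r1, φ r / φ q ^ (m + 1) = τ h + φ r1 / φ q := by
  have hq0 : φ q ≠ 0 := (map_ne_zero_iff φ hφ).2 hq.ne_zero
  induction m with
  | zero => intro r; exact ⟨0, L.zero_mem, r, by simp⟩
  | succ m ih =>
    intro r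
    obtain ⟨a, b, hab⟩ := (hq.coprime_iff_not_dvd).2 (not_dvd_derivative hq)
    obtain ⟨h, hh, r1, e⟩ := ih (r * a + C (1 / ((m : F) + 1)) * derivative (r * b))
    have hm : (m : F) + 1 ≠ 0 := by exact_mod_cast Nat.succ_ne_zero m
    have hmK : (m : K) + 1 ≠ 0 := by exact_mod_cast Nat.succ_ne_zero m
    have hCm : φ (C (1 / ((m : F) + 1))) = 1 / ((m : K) + 1) := by
      have : (φ.comp C) (1 / ((m : F) + 1)) = 1 / ((m : K) + 1) := by
        rw [map_div₀, map_add, map_natCast, map_one]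
      exact this
    refine ⟨h + -(φ (r * b) / (((m : K) + 1) * φ q ^ (m+1))), ?_, r1, ?_⟩
    · refine L.add_mem hh (L.neg_mem (L.div_mem (hL _) (L.mul_mem ?_ (L.pow_mem (hL _) _))))
      exact L.add_mem (natCast_mem L m) L.one_mem
    · have hr : φ r = φ (r * a) * φ q + φ (r * b) * φ (derivative q) := by
        rw [← map_mul, ← map_mul, ← map_add]
        congr 1
        linear_combination (-r) * hab
      have t1 : τ ((m : K) + 1) = 0 := by simp
      rw [map_add τ, add_right_comm (τ h), ← e, hr, map_neg, Derivation.leibniz_div]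
      generalize r * b = B
      simp only [Derivation.leibniz _ ((m : K) + 1), Derivation.leibniz_pow, smul_eq_mul,
        nsmul_eq_mul, t1, hτ, map_add, map_mul, hCm, Nat.add_sub_cancel]
      push_cast
      field_simp
      ring

lemma reduce
    (hφ : Function.Injective φ) [CharZero F] [CharZero K] (τ : Derivation ℤ K K)
    (hτ : ∀ p, τ (φ p) = φ (derivative p))
    (L : Subfield K) (hL : ∀ p, φ p ∈ L) (β : K) (hβ : ∃ P Q : F[X], β = φ P / φ Q) :
    ∃ h ∈ L, ∃ (s : Finset F[X]) (r : F[X] → F[X]),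
      (∀ q ∈ s, Irreducible q ∧ q.Monic ∧ (r q).degree < q.degree) ∧
      β = τ h + ∑ q ∈ s, φ (r q) / φ q := by
  classical
  obtain ⟨P, Q, rfl⟩ := hβ
  by_cases hQ : Q = 0
  · exact ⟨0, L.zero_mem, ∅, 0, by simp, by simp [hQ]⟩
  set s := (UniqueFactorizationMonoid.normalizedFactors Q).toFinset with hs
  have hirr : ∀ q ∈ s, Irreducible q := fun q hq =>
    UniqueFactorizationMonoid.irreducible_of_normalized_factor q (Multiset.mem_toFinset.1 hq)
  have hmon : ∀ q ∈ s, q.Monic := by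
    intro q hq
    have := UniqueFactorizationMonoid.normalize_normalized_factor q (Multiset.mem_toFinset.1 hq)
    rw [← this]; exact monic_normalize (hirr q hq).ne_zero
  have hcop : Set.Pairwise (s : Set F[X]) fun i j => IsCoprime (id i) (id j) := by
    intro i hi j hj hij
    refine ((hirr i hi).coprime_iff_not_dvd).2 fun hd => hij ?_
    exact eq_of_monic_of_associated (hmon i hi) (hmon j hj)
      ((hirr i hi).associated_of_dvd (hirr j hj) hd)
  obtain ⟨u, hu⟩ := UniqueFactorizationMonoid.prod_normalizedFactors hQ
  have hu0 : (u : F[X]) ≠ 0 := u.ne_zero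
  let _ : Algebra F[X] K := φ.toAlgebra
  obtain ⟨q0, r0, -, e⟩ := mul_prod_pow_inverse_eq_quo_add_sum_rem_mul_pow_inverse (K := K)
    (P * (↑u⁻¹ : F[X])) (g := id) hmon hcop
    (fun q => (UniqueFactorizationMonoid.normalizedFactors Q).count q)
    (gi := fun q => (φ q)⁻¹) (fun q hq =>
      inv_mul_cancel₀ ((map_ne_zero_iff φ hφ).2 (hirr q hq).ne_zero))
  change φ _ * _ = φ _ + ∑ i ∈ s, ∑ j, φ _ * _ at e
  have hPQ : φ P / φ Q = φ (P * (↑u⁻¹ : F[X])) *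
      ∏ i ∈ s, (φ i)⁻¹ ^ (UniqueFactorizationMonoid.normalizedFactors Q).count i := by
    have hu1 : φ (u : F[X]) * φ (↑u⁻¹ : F[X]) = 1 := by rw [← map_mul]; simp
    have hu2 : φ (u : F[X]) ≠ 0 := (map_ne_zero_iff φ hφ).2 hu0
    have hu3 : φ (↑u⁻¹ : F[X]) = (φ (u : F[X]))⁻¹ := eq_inv_of_mul_eq_one_right hu1
    conv_lhs => rw [← hu]
    rw [Finset.prod_multiset_count, map_mul, map_prod, map_mul, hu3]
    simp only [inv_pow, Finset.prod_inv_distrib, map_pow]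
    rw [← hs]
    field_simp
  rw [hPQ, e]
  -- reduce each term
  have hterm : ∀ q ∈ s, ∃ h ∈ L, ∃ r1 : F[X], r1.degree < q.degree ∧
      ∑ j, φ (r0 q j) * (φ q)⁻¹ ^ (j.1 + 1) = τ h + φ r1 / φ q := by
    intro q hq
    have hq0 : φ q ≠ 0 := (map_ne_zero_iff φ hφ).2 (hirr q hq).ne_zero
    choose h hh r1 e1 using fun j : Fin ((UniqueFactorizationMonoid.normalizedFactors Q).count q) =>
      hermite hφ (hirr q hq) τ hτ L hL j.1 (r0 q j)
    obtain ⟨A, hA⟩ := antideriv ((∑ j, r1 j) /ₘ q)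
    refine ⟨∑ j, h j + φ A, L.add_mem (L.sum_mem fun j _ => hh j) (hL _),
      (∑ j, r1 j) %ₘ q, degree_modByMonic_lt _ (hmon q hq), ?_⟩
    have e2 : φ (∑ j, r1 j) = φ ((∑ j, r1 j) %ₘ q) + φ q * φ ((∑ j, r1 j) /ₘ q) := by
      rw [← map_mul, ← map_add, modByMonic_add_div]
    have e3 : ∀ j, φ (r0 q j) * (φ q)⁻¹ ^ (j.1 + 1) = τ (h j) + φ (r1 j) / φ q := by
      intro j; rw [← e1, inv_pow, div_eq_mul_inv]
    simp only [e3]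
    rw [Finset.sum_add_distrib, ← Finset.sum_div, ← map_sum φ, e2, map_add, map_sum τ, hτ, hA]
    field_simp
    ring
  choose! h hh r1 hr1 e1 using hterm
  obtain ⟨A, hA⟩ := antideriv q0
  refine ⟨φ A + ∑ q ∈ s, h q, L.add_mem (hL _) (L.sum_mem hh), s, r1,
    fun q hq => ⟨hirr q hq, hmon q hq, hr1 q hq⟩, ?_⟩
  rw [Finset.sum_congr rfl e1, Finset.sum_add_distrib, map_add, map_sum τ, hτ, hA]
  ring

lemma core
    (hφ : Function.Injective φ) [CharZero F] [CharZero K] {k : Type*} [Field k] [IsAlgClosed k] [Algebra k F]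
    {ι : Type*}
    (d : ι → F →+ F) (D : ι → Derivation ℤ K K) (τ : Derivation ℤ K K)
    (hτ : ∀ p, τ (φ p) = φ (derivative p))
    (hC : ∀ j a, D j (φ (C a)) = φ (C (d j a))) (hX : ∀ j, D j (φ X) = 0)
    (hk : ∀ a : F, (∀ j, d j a = 0) → a ∈ (algebraMap k F).range)
    (h1 : ∀ j, d j 1 = 0)
    (hc : ∀ j z, D j (τ z) = τ (D j z))
    (L : Subfield K) (hL : ∀ p, φ p ∈ L) (hL' : ∀ z ∈ L, ∃ P Q : F[X], z = φ P / φ Q)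
    (hDL : ∀ j, ∀ z ∈ L, D j z ∈ L)
    (β : K) (hβ : β ∈ L) (b : ι → K) (hb : ∀ j, b j ∈ L) (hβb : ∀ j, D j β = τ (b j)) :
    ∃ h ∈ L, ∃ (s : Finset F[X]) (c : F[X] → k), (∀ q ∈ s, q ≠ 0) ∧
      β = τ h + ∑ q ∈ s, φ (C (algebraMap k F (c q))) * τ (φ q) / φ q := by
  classical
  obtain ⟨h, hh, s, r, hs, e⟩ := reduce hφ τ hτ L hL β (hL' β hβ)
  have hD : ∀ j p, D j (φ p) = φ (cm (d j) p) := by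
    intro j p
    have := chain φ (D j) (d j) (hC j) p X
    simpa [hX] using this
  have key : ∀ q ∈ s, ∃ c : k, r q = C (algebraMap k F c) * derivative q := by
    intro q hq
    obtain ⟨hirr, hmon, hdeg⟩ := hs q hq
    have hq0 : φ q ≠ 0 := (map_ne_zero_iff φ hφ).2 hirr.ne_zero
    obtain ⟨a, a', haa⟩ := (hirr.coprime_iff_not_dvd).2 (not_dvd_derivative hirr)
    have hr : r q = (r q * a') * derivative q + q * (r q * a) := by
      linear_combination (-(r q)) * haa
    set ρ := r q * a' with hρ
    have hG : Reg φ q (φ (r q * a) + ∑ p ∈ s.erase q, φ (r p) / φ p) := by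
      refine (Reg.of hirr _).add hirr (Reg.sum hirr _ _ ?_)
      intro p hp
      obtain ⟨hpq, hps⟩ := Finset.mem_erase.1 hp
      obtain ⟨pirr, pmon, -⟩ := hs p hps
      refine ⟨r p, p, fun hd => hpq ?_, ?_⟩
      · exact (eq_of_monic_of_associated hmon pmon (hirr.associated_of_dvd pirr hd)).symm
      · have hp0 : φ p ≠ 0 := (map_ne_zero_iff φ hφ).2 pirr.ne_zero
        field_simp
    have hjac : ∀ j, q ∣ cm (d j) ρ * derivative q - derivative ρ * cm (d j) q := by
      intro j
      refine resid hφ hirr τ (D j) hτ _ (hD j) (hc j) ρ _ (b j - D j h) hG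
        (hL' _ (L.sub_mem (hb j) (hDL j _ hh))) ?_
      have e2 : φ ρ * φ (derivative q) / φ q +
          (φ (r q * a) + ∑ p ∈ s.erase q, φ (r p) / φ p) = β - τ h := by
        rw [e, ← Finset.add_sum_erase s _ hq]
        have := congrArg φ hr
        rw [map_add, map_mul, map_mul φ q] at this
        rw [this]
        field_simp
        ring
      rw [e2, map_sub, map_sub, hβb, hc]
    obtain ⟨c, hcq⟩ := const hφ d D τ hτ hC hX hk h1 hirr ρ hjac
    refine ⟨c, ?_⟩
    rw [← sub_eq_zero]
    apply eq_zero_of_dvd_of_degree_lt (p := q)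
    · have : r q - C (algebraMap k F c) * derivative q =
          (ρ - C (algebraMap k F c)) * derivative q + q * (r q * a) := by
        linear_combination hr
      rw [this]
      exact dvd_add (dvd_mul_of_dvd_left hcq _) (dvd_mul_right _ _)
    · refine (degree_sub_le _ _).trans_lt (max_lt hdeg ?_)
      refine lt_of_le_of_lt ?_ (degree_derivative_lt hirr.ne_zero)
      rw [C_mul']
      exact degree_smul_le _ _
  choose! c hc' using key
  refine ⟨h, hh, s, c, fun q hq => (hs q hq).1.ne_zero, ?_⟩
  rw [e]
  congr 1
  refine Finset.sum_congr rfl fun q hq => ?_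
  rw [hc' q hq, map_mul, hτ]

end core

section ind
variable {F K : Type*} [Field F] [Field K] [CharZero F]

lemma inj_of_der (φ : F[X] →+* K) (τ : Derivation ℤ K K)
    (hτ : ∀ p, τ (φ p) = φ (derivative p)) : Function.Injective φ := by
  rw [injective_iff_map_eq_zero]
  have : ∀ N, ∀ p : F[X], p.natDegree ≤ N → φ p = 0 → p = 0 := by
    intro N
    induction N with
    | zero =>
      intro p hp h
      rw [eq_C_of_natDegree_le_zero hp] at h ⊢
      have h' : (φ.comp C) (p.coeff 0) = 0 := h
      rw [(map_eq_zero (φ.comp C)).1 h', C_0]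
    | succ N ih =>
      intro p hp h
      by_cases h0 : p.natDegree = 0
      · exact ih p (by omega) h
      · have h1 : derivative p = 0 := by
          apply ih _ _ (by rw [← hτ, h, map_zero])
          have := natDegree_derivative_lt h0
          omega
        exact absurd (derivative_eq_zero.1 h1) h0
  exact fun p hp => this _ p le_rfl hp

lemma ker_der (φ : F[X] →+* K) (τ : Derivation ℤ K K)
    (hτ : ∀ p, τ (φ p) = φ (derivative p)) (z : K) (hz : τ z = 0) :
    ∀ N, ∀ P Q : F[X], Q.natDegree ≤ N → Q ≠ 0 → z * φ Q = φ P → ∃ a, z = φ (C a) := by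
  have hφ := inj_of_der φ τ hτ
  intro N
  induction N with
  | zero =>
    intro P Q hQ hQ0 h
    obtain ⟨c, rfl⟩ : ∃ c, Q = C c := ⟨_, eq_C_of_natDegree_le_zero hQ⟩
    have hc : c ≠ 0 := by rintro rfl; simp at hQ0
    have e : z = φ (C c⁻¹ * P) := by
      rw [map_mul, ← h, mul_left_comm, ← map_mul, ← C_mul, inv_mul_cancel₀ hc]; simp
    have h1 : derivative (C c⁻¹ * P) = 0 := by
      apply hφ
      rw [← hτ, ← e, hz, map_zero]
    refine ⟨_, e.trans (congrArg φ (eq_C_of_natDegree_le_zero (derivative_eq_zero.1 h1).le))⟩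
  | succ N ih =>
    intro P Q hQ hQ0 h
    by_cases h0 : Q.natDegree = 0
    · exact ih P Q (by omega) hQ0 h
    · apply ih (derivative P) (derivative Q)
      · have := natDegree_derivative_lt h0
        omega
      · exact fun h1 => h0 (derivative_eq_zero.1 h1)
      · have := congrArg τ h
        simpa [hτ, hz] using this

end ind

section main
variable {k K : Type*} [Field k] [Field K] [Algebra k K] {n : ℕ}

/-- forms of Darboux type -/
def S (k : Type*) [Field k] [Algebra k K] (D : Fin n → Derivation ℤ K K) :
    AddSubmonoid (Fin n → K) :=
  AddSubmonoid.closure ({α | ∃ h, α = fun i => D i h} ∪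
    {α | ∃ (c : k) (f : K), f ≠ 0 ∧ α = fun i => algebraMap k K c * D i f / f})

/-- subfield generated by the first `m` variables -/
def Fm (k : Type*) [Field k] [Algebra k K] (x : Fin n → K) (m : ℕ) : IntermediateField k K :=
  IntermediateField.adjoin k (x '' {i | i.val < m})

variable {x : Fin n → K} {D : Fin n → Derivation ℤ K K}

lemma Fm_zero
    (hDx : ∀ i j, D i (x j) = if i = j then 1 else 0)
    (hDC : ∀ i (c : k), D i (algebraMap k K c) = 0) {m : ℕ} {i : Fin n} (hi : m ≤ i.val) {z : K} (hz : z ∈ Fm k x m) : D i z = 0 := by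
  induction hz using IntermediateField.adjoin_induction with
  | mem y hy =>
    obtain ⟨j, hj, rfl⟩ := hy
    have hj' : j.val < m := hj
    rw [hDx, if_neg]
    rintro rfl; omega
  | algebraMap c => exact hDC i c
  | add y z _ _ hy hz => rw [map_add, hy, hz, add_zero]
  | inv y _ hy => rw [Derivation.leibniz_inv, hy, smul_zero]
  | mul y z _ _ hy hz => rw [Derivation.leibniz, hy, hz, smul_zero, smul_zero, add_zero]

lemma Fm_der
    (hDx : ∀ i j, D i (x j) = if i = j then 1 else 0)
    (hDC : ∀ i (c : k), D i (algebraMap k K c) = 0) {m : ℕ} (i : Fin n) {z : K} (hz : z ∈ Fm k x m) : D i z ∈ Fm k x m := by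
  induction hz using IntermediateField.adjoin_induction with
  | mem y hy =>
    obtain ⟨j, hj, rfl⟩ := hy
    rw [hDx]
    split_ifs
    · exact one_mem _
    · exact zero_mem _
  | algebraMap c => rw [hDC]; exact zero_mem _
  | add y z _ _ hy hz => rw [map_add]; exact add_mem hy hz
  | inv y hy' hy =>
    rw [Derivation.leibniz_inv, smul_eq_mul]
    exact mul_mem (neg_mem (pow_mem (inv_mem hy') _)) hy
  | mul y z hy' hz' hy hz =>
    rw [Derivation.leibniz, smul_eq_mul, smul_eq_mul]
    exact add_mem (mul_mem hy' hz) (mul_mem hz' hy)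

/-- evaluation at the next variable -/
noncomputable def ev (k : Type*) [Field k] [Algebra k K] (x : Fin n → K) (i : Fin n) :
    (Fm k x i.val)[X] →+* K := (aeval (x i) : (Fm k x i.val)[X] →ₐ[Fm k x i.val] K).toRingHom

lemma ev_C (i : Fin n) (a : Fm k x i.val) : ev k x i (C a) = (a : K) := by
  simp [ev]

lemma ev_X (i : Fin n) : ev k x i X = x i := by simp [ev]

lemma Fm_succ (i : Fin n) (z : K) :
    z ∈ Fm k x (i.val + 1) ↔ ∃ P Q, z = ev k x i P / ev k x i Q := by
  have hset : x '' {j | j.val < i.val + 1} = x '' {j | j.val < i.val} ∪ {x i} := by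
    rw [← Set.image_singleton, ← Set.image_union]
    congr 1
    ext j
    simp only [Set.mem_ofPred_eq, Set.mem_union, Set.mem_singleton_iff, Fin.ext_iff]
    omega
  have h1 : Fm k x (i.val + 1) =
      (IntermediateField.adjoin (Fm k x i.val) {x i}).restrictScalars k := by
    unfold Fm
    rw [hset, IntermediateField.adjoin_adjoin_left]
  rw [h1, IntermediateField.mem_restrictScalars, IntermediateField.mem_adjoin_simple_iff]
  rfl

lemma ev_der
    (hDx : ∀ i j, D i (x j) = if i = j then 1 else 0)
    (hDC : ∀ i (c : k), D i (algebraMap k K c) = 0) (i : Fin n) (p) : D i (ev k x i p) = ev k x i (derivative p) := by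
  have h := chain (ev k x i) (D i) 0 (fun a => by
    rw [ev_C, Fm_zero hDx hDC le_rfl a.2]; simp) p X
  have h0 : cm (0 : (Fm k x i.val) →+ (Fm k x i.val)) p = 0 := by ext j; simp [coeff_cm]
  simpa [h0, ev_X, hDx] using h

lemma Fm_desc
    (hDx : ∀ i j, D i (x j) = if i = j then 1 else 0)
    (hDC : ∀ i (c : k), D i (algebraMap k K c) = 0) [CharZero k] (i : Fin n) {z : K} (hz : z ∈ Fm k x (i.val + 1)) (h : D i z = 0) :
    z ∈ Fm k x i.val := by
  have : CharZero (Fm k x i.val) := charZero_of_injective_algebraMap (algebraMap k _).injective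
  obtain ⟨P, Q, e⟩ := (Fm_succ i z).1 hz
  have hd := ev_der hDx hDC (k := k) i
  have hinj := inj_of_der _ _ hd
  by_cases hQ : Q = 0
  · rw [e, hQ]; simp
  have hQ' : ev k x i Q ≠ 0 := (map_ne_zero_iff _ hinj).2 hQ
  obtain ⟨a, ha⟩ := ker_der _ _ hd z h _ P Q le_rfl hQ (by rw [e]; field_simp)
  rw [ha, ev_C]
  exact a.2

lemma consts
    (hDx : ∀ i j, D i (x j) = if i = j then 1 else 0)
    (hDC : ∀ i (c : k), D i (algebraMap k K c) = 0) [CharZero k] (m : ℕ) (hm : m ≤ n) {z : K} (hz : z ∈ Fm k x m)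
    (h : ∀ i, D i z = 0) : ∃ c, algebraMap k K c = z := by
  induction m with
  | zero =>
    have : Fm k x 0 = ⊥ := by simp [Fm]
    rw [this] at hz
    exact IntermediateField.mem_bot.1 hz
  | succ m ih => exact ih (by omega) (Fm_desc hDx hDC ⟨m, by omega⟩ hz (h _))

lemma step
    (hDx : ∀ i j, D i (x j) = if i = j then 1 else 0)
    (hDC : ∀ i (c : k), D i (algebraMap k K c) = 0)
    (hcomm : ∀ i j z, D i (D j z) = D j (D i z)) [CharZero k] [IsAlgClosed k] (m : ℕ) (hm : m ≤ n) :
    ∀ α : Fin n → K, (∀ i j, D j (α i) = D i (α j)) → (∀ i, α i ∈ Fm k x m) →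
      (∀ i, m ≤ i.val → α i = 0) → α ∈ S k D := by
  classical
  induction m with
  | zero =>
    intro α _ _ h
    have : α = 0 := by ext i; exact h i (Nat.zero_le _)
    rw [this]; exact zero_mem _
  | succ m ih =>
    intro α hcl hmem hzero
    let i : Fin n := ⟨m, by omega⟩
    have : CharZero (Fm k x i.val) := charZero_of_injective_algebraMap (algebraMap k _).injective
    have : CharZero K := charZero_of_injective_algebraMap (algebraMap k K).injective
    have hd := ev_der hDx hDC (k := k) i
    have hinj := inj_of_der _ _ hd
    let d : {j : Fin n // j.val < m} → (Fm k x i.val) →+ (Fm k x i.val) := fun j =>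
      { toFun := fun a => ⟨D j.1 a, Fm_der hDx hDC j.1 a.2⟩
        map_zero' := by ext; simp
        map_add' := fun a b => by ext; simp }
    have hL : ∀ p, ev k x i p ∈ Fm k x (m + 1) := fun p =>
      (Fm_succ i _).2 ⟨p, 1, by simp⟩
    obtain ⟨h, hh, s, c, hs, e⟩ := core (k := k) hinj d (fun j => D j.1) (D i) hd
      (fun j a => by rw [ev_C, ev_C]; rfl)
      (fun j => by
        rw [ev_X, hDx, if_neg]
        intro hji
        have := j.2
        rw [hji] at this
        exact lt_irrefl _ this)
      (fun a ha => by
        obtain ⟨c, hc⟩ := consts hDx hDC m (by omega) (z := (a : K)) a.2 (fun j => by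
          by_cases hj : j.val < m
          · exact congrArg Subtype.val (ha ⟨j, hj⟩)
          · exact Fm_zero hDx hDC (not_lt.1 hj) a.2)
        exact ⟨c, Subtype.ext hc⟩)
      (fun j => by ext; simp [d])
      (fun j z => hcomm _ _ z)
      (Fm k x (m + 1)).toSubfield hL (fun z hz => (Fm_succ i z).1 hz)
      (fun j z hz => Fm_der hDx hDC j.1 hz)
      (α i) (hmem i) (fun j => α j.1) (fun j => hmem _) (fun j => hcl _ _)
    have hev : ∀ a : k, ev k x i (C (algebraMap k (Fm k x i.val) a)) = algebraMap k K a :=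
      fun a => by rw [ev_C]; rfl
    simp only [hev] at e
    let β : Fin n → K := fun l => ∑ q ∈ s, algebraMap k K (c q) * D l (ev k x i q) / ev k x i q
    let α' : Fin n → K := fun l => α l - D l h - β l
    have hβcl : ∀ a b, D b (β a) = D a (β b) := by
      intro a b
      simp only [β, map_sum]
      refine Finset.sum_congr rfl fun q hq => ?_
      have hq0 : ev k x i q ≠ 0 := (map_ne_zero_iff _ hinj).2 (hs q hq)
      rw [Derivation.leibniz_div, Derivation.leibniz_div]
      simp only [Derivation.leibniz, smul_eq_mul, hDC, hcomm a b]
      ring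
    have hcl' : ∀ a b, D b (α' a) = D a (α' b) := by
      intro a b
      simp only [α', map_sub, hcl a b, hcomm a b, hβcl a b]
    have hβmem : ∀ l, β l ∈ Fm k x (m + 1) := fun l =>
      sum_mem fun q hq => div_mem (mul_mem (IntermediateField.algebraMap_mem _ _)
        (Fm_der hDx hDC l (hL q))) (hL q)
    have hi0 : α' i = 0 := by
      simp only [α', β]
      rw [e]; ring
    have hα' : α' ∈ S k D := by
      refine ih (by omega) α' hcl' (fun l => ?_) (fun l hl => ?_)
      · refine Fm_desc hDx hDC i (z := α' l)
          (sub_mem (sub_mem (hmem l) (Fm_der hDx hDC l hh)) (hβmem l)) ?_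
        rw [hcl' l i, hi0, map_zero]
      · rcases hl.eq_or_lt with hl | hl
        · have : l = i := Fin.ext hl.symm
          rw [this, hi0]
        · have hβ0 : β l = 0 := Finset.sum_eq_zero fun q hq => by
            rw [Fm_zero hDx hDC (m := m + 1) hl (hL q)]; simp
          simp only [α']
          rw [hβ0, hzero l hl, Fm_zero hDx hDC (m := m + 1) hl hh]; simp
    have hdec : α = α' + (fun l => D l h) +
        ∑ q ∈ s, (fun l => algebraMap k K (c q) * D l (ev k x i q) / ev k x i q) := by
      ext l
      simp only [Pi.add_apply, Finset.sum_apply, α', β]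
      ring
    rw [hdec]
    refine add_mem (add_mem hα' ?_) (sum_mem fun q hq => ?_)
    · exact AddSubmonoid.subset_closure (Or.inl ⟨h, rfl⟩)
    · exact AddSubmonoid.subset_closure
        (Or.inr ⟨c q, _, (map_ne_zero_iff _ hinj).2 (hs q hq), rfl⟩)

end main
end Darb
open MvPolynomial

/-- every closed rational 1-form `α = ∑ αᵢ dxᵢ` over
`K = ℂ(x₁,…,xₙ)` is the logarithmic differential of a Darboux function:
`α = d(g/f) + ∑ aₖ dfₖ/fₖ` with polynomials `g, f, fₖ` and constants `aₖ ∈ ℂ`.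
Here `K` is realized as the fraction field of `ℂ[x₁,…,xₙ]` and `D i` are the
partial derivations, characterized by their values on variables and constants
together with commutativity. -/
theorem closed_rational_one_form_is_darboux
    (n : ℕ)
    (K : Type*) [Field K] [Algebra (MvPolynomial (Fin n) ℂ) K]
    [IsFractionRing (MvPolynomial (Fin n) ℂ) K]
    (D : Fin n → Derivation ℤ K K)
    (hDX : ∀ i j, D i (algebraMap (MvPolynomial (Fin n) ℂ) K (X j))
      = if i = j then 1 else 0)
    (hDC : ∀ i (c : ℂ), D i (algebraMap (MvPolynomial (Fin n) ℂ) K (C c)) = 0)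
    (hcomm : ∀ i j (x : K), D i (D j x) = D j (D i x))
    (α : Fin n → K)
    (hclosed : ∀ i j, D j (α i) = D i (α j)) :
    ∃ (g f : MvPolynomial (Fin n) ℂ) (_ : f ≠ 0)
      (r : ℕ) (fs : Fin r → MvPolynomial (Fin n) ℂ) (_ : ∀ k, fs k ≠ 0)
      (a : Fin r → ℂ),
      ∀ i, α i =
        D i (algebraMap (MvPolynomial (Fin n) ℂ) K g /
              algebraMap (MvPolynomial (Fin n) ℂ) K f) +
        ∑ k, algebraMap (MvPolynomial (Fin n) ℂ) K (C (a k)) *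
          D i (algebraMap (MvPolynomial (Fin n) ℂ) K (fs k)) /
          algebraMap (MvPolynomial (Fin n) ℂ) K (fs k) := by
  classical
  let R := MvPolynomial (Fin n) ℂ
  let ψ : ℂ →+* K := (algebraMap (MvPolynomial (Fin n) ℂ) K).comp C
  let _ : Algebra ℂ K := ψ.toAlgebra
  have hψ : ∀ c, algebraMap ℂ K c = algebraMap (MvPolynomial (Fin n) ℂ) K (C c) := fun c => rfl
  have hinj : Function.Injective (algebraMap (MvPolynomial (Fin n) ℂ) K) :=
    IsFractionRing.injective _ _
  let x : Fin n → K := fun j => algebraMap (MvPolynomial (Fin n) ℂ) K (X j)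
  have hpoly : ∀ p, algebraMap (MvPolynomial (Fin n) ℂ) K p ∈ Darb.Fm ℂ x n := by
    intro p
    induction p using MvPolynomial.induction_on with
    | C c => rw [← hψ]; exact IntermediateField.algebraMap_mem _ _
    | add p q hp hq => rw [map_add]; exact add_mem hp hq
    | mul_X p j hp =>
      rw [map_mul]
      exact mul_mem hp (IntermediateField.subset_adjoin _ _ ⟨j, j.2, rfl⟩)
  have hfrac : ∀ z : K, ∃ p q : MvPolynomial (Fin n) ℂ, q ≠ 0 ∧
      z = algebraMap (MvPolynomial (Fin n) ℂ) K p / algebraMap (MvPolynomial (Fin n) ℂ) K q := by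
    intro z
    obtain ⟨p, q, hq, rfl⟩ := IsFractionRing.div_surjective (A := MvPolynomial (Fin n) ℂ) z
    exact ⟨p, q, nonZeroDivisors.ne_zero hq, rfl⟩
  have hα : α ∈ Darb.S ℂ D := by
    refine Darb.step (x := x) hDX hDC hcomm n le_rfl α hclosed (fun i => ?_)
      (fun i hi => absurd i.2 (not_lt.2 hi))
    obtain ⟨p, q, -, e⟩ := hfrac (α i)
    rw [e]
    exact div_mem (hpoly p) (hpoly q)
  -- extraction
  suffices H : ∃ (h : K) (r : ℕ) (fs : Fin r → MvPolynomial (Fin n) ℂ) (_ : ∀ k, fs k ≠ 0)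
      (a : Fin r → ℂ), ∀ i, α i = D i h +
        ∑ k, algebraMap (MvPolynomial (Fin n) ℂ) K (C (a k)) *
          D i (algebraMap (MvPolynomial (Fin n) ℂ) K (fs k)) /
          algebraMap (MvPolynomial (Fin n) ℂ) K (fs k) by
    obtain ⟨h, r, fs, hfs, a, e⟩ := H
    obtain ⟨g, f, hf, rfl⟩ := hfrac h
    exact ⟨g, f, hf, r, fs, hfs, a, e⟩
  clear hclosed
  unfold Darb.S at hα
  induction hα using AddSubmonoid.closure_induction with
  | mem α hα =>
    rcases hα with ⟨h, rfl⟩ | ⟨c, f, hf, rfl⟩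
    · exact ⟨h, 0, Fin.elim0, fun k => k.elim0, Fin.elim0, fun i => by simp⟩
    · obtain ⟨p, q, hq, rfl⟩ := hfrac f
      have hp : p ≠ 0 := by rintro rfl; simp at hf
      refine ⟨0, 2, ![p, q], ?_, ![c, -c], fun i => ?_⟩
      · intro k; fin_cases k
        · exact hp
        · exact hq
      · have hp' := (map_ne_zero_iff _ hinj).2 hp
        have hq' := (map_ne_zero_iff _ hinj).2 hq
        beta_reduce
        rw [Fin.sum_univ_two, hψ, Derivation.leibniz_div]
        simp only [Matrix.cons_val_zero, Matrix.cons_val_one, map_neg, map_zero, smul_eq_mul]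
        field_simp
        ring
  | zero => exact ⟨0, 0, Fin.elim0, fun k => k.elim0, Fin.elim0, fun i => by simp⟩
  | add α β _ _ hα hβ =>
    obtain ⟨h, r, fs, hfs, a, e⟩ := hα
    obtain ⟨h', r', fs', hfs', a', e'⟩ := hβ
    refine ⟨h + h', r + r', Fin.append fs fs', ?_, Fin.append a a', fun i => ?_⟩
    · intro k
      refine Fin.addCases (fun k => ?_) (fun k => ?_) k
      · rw [Fin.append_left]; exact hfs k
      · rw [Fin.append_right]; exact hfs' k
    · rw [Pi.add_apply, e, e', Fin.sum_univ_add]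
      simp only [Fin.append_left, Fin.append_right, map_add]
      ring
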